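/- Let I be a square-free monomial ideal of S generated in degree k ≥ 1 and let u_1,…,u_t ∈ G(I) form an induced matching with t ≥ 3. Then for every integer s ≥ 2 and all pairwise distinct indices i, j, l: the elements of G(I^s) dividing u_i^s u_j u_l are exactly the four distinct monomials u_i^s, u_i^{s-1} u_j, u_i^{s-1} u_l, and u_i^{s-2} u_j u_l. -/

import Mathlib

open MvPolynomial

/-- The monomial ideal of `MvPolynomial (Fin n) K` generated by the monomials
whose exponent vectors lie in `A`. -/
noncomputable def mIdeal (K : Type) [Field K] {n : ℕ} (A : Set (Fin n →₀ ℕ)) :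
    Ideal (MvPolynomial (Fin n) K) :=
  Ideal.span ((fun a => monomial a (1 : K)) '' A)

/-- `G` is the (unique) minimal set of monomial generators of the monomial ideal `I`:
the monomials with exponent vectors in `G` generate `I`, and `G` is an antichain with
respect to divisibility of monomials (i.e. the pointwise order on exponent vectors). -/
def IsMinGen (K : Type) [Field K] {n : ℕ} (G : Finset (Fin n →₀ ℕ))
    (I : Ideal (MvPolynomial (Fin n) K)) : Prop :=
  I = mIdeal K (↑G : Set (Fin n →₀ ℕ)) ∧ ∀ a ∈ G, ∀ b ∈ G, a ≤ b → a = b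

/-- The set of `s`-fold sums of elements of `A`. -/
def sumsOfCard {M : Type*} [AddCommMonoid M] (A : Set M) (s : ℕ) : Set M :=
  {m | ∃ T : Multiset M, T.card = s ∧ (∀ a ∈ T, a ∈ A) ∧ T.sum = m}

theorem monomial_mem_mIdeal_iff {K : Type} [Field K] {n : ℕ} {A : Set (Fin n →₀ ℕ)}
    {w : Fin n →₀ ℕ} : monomial w (1 : K) ∈ mIdeal K A ↔ ∃ a ∈ A, a ≤ w := by
  classical
  rw [mIdeal, mem_ideal_span_monomial_image, support_monomial, if_neg one_ne_zero]
  simp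

theorem mIdeal_pow {K : Type} [Field K] {n : ℕ} (A : Set (Fin n →₀ ℕ)) (s : ℕ) :
    mIdeal K A ^ s = mIdeal K (sumsOfCard A s) := by
  induction s with
  | zero =>
    symm
    rw [pow_zero, Ideal.one_eq_top, Ideal.eq_top_iff_one]
    exact monomial_mem_mIdeal_iff.2 ⟨0, ⟨0, by simp⟩, le_rfl⟩
  | succ s ih =>
    rw [pow_succ, ih, mIdeal, mIdeal, mIdeal, Ideal.span_mul_span']
    congr 1
    ext f
    simp only [Set.mem_mul, Set.mem_image]
    constructor
    · rintro ⟨_, ⟨_, ⟨T, hc, hT, rfl⟩, rfl⟩, _, ⟨b, hb, rfl⟩, rfl⟩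
      refine ⟨T.sum + b, ⟨b ::ₘ T, by simp [hc], ?_, by simp [add_comm]⟩,
        by simp [monomial_mul]⟩
      simpa using ⟨hb, hT⟩
    · rintro ⟨_, ⟨T, hc, hT, rfl⟩, rfl⟩
      obtain ⟨b, hb⟩ := Multiset.card_pos_iff_exists_mem.1 (by omega : 0 < T.card)
      obtain ⟨T, rfl⟩ := Multiset.exists_cons_of_mem hb
      simp only [Multiset.card_cons, Nat.add_right_cancel_iff] at hc
      refine ⟨_, ⟨T.sum, ⟨T, hc, fun a ha => hT a (Multiset.mem_cons_of_mem ha), rfl⟩, rfl⟩,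
        _, ⟨b, hT b hb, rfl⟩, ?_⟩
      simp [monomial_mul, add_comm]

/-- An antichain generating a monomial ideal is its minimal set of monomial generators. -/
theorem IsMinGen.mem_iff_of_antichain {K : Type} [Field K] {n : ℕ} {H : Finset (Fin n →₀ ℕ)}
    {P : Set (Fin n →₀ ℕ)} (hH : IsMinGen K H (mIdeal K P))
    (hP : ∀ a ∈ P, ∀ b ∈ P, a ≤ b → a = b) (w : Fin n →₀ ℕ) : w ∈ H ↔ w ∈ P := by
  obtain ⟨heq, hanti⟩ := hH
  have down : ∀ p ∈ P, ∃ a ∈ H, a ≤ p := fun p hp => by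
    have h : monomial p (1 : K) ∈ mIdeal K P := monomial_mem_mIdeal_iff.2 ⟨p, hp, le_rfl⟩
    rw [heq] at h
    simpa using monomial_mem_mIdeal_iff.1 h
  have up : ∀ a ∈ H, a ∈ P := fun a ha => by
    have h : monomial a (1 : K) ∈ mIdeal K (H : Set (Fin n →₀ ℕ)) :=
      monomial_mem_mIdeal_iff.2 ⟨a, ha, le_rfl⟩
    rw [← heq] at h
    obtain ⟨p, hp, hpa⟩ := monomial_mem_mIdeal_iff.1 h
    obtain ⟨b, hb, hbp⟩ := down p hp
    have hba := hanti b hb a ha (hbp.trans hpa)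
    rwa [← le_antisymm hpa (hba ▸ hbp)]
  refine ⟨up w, fun hw => ?_⟩
  obtain ⟨a, ha, haw⟩ := down w hw
  rwa [← hP a (up a ha) w hw haw]

theorem Finsupp.eq_of_le_of_degree_eq {σ : Type*} {a b : σ →₀ ℕ} (h : a ≤ b)
    (hd : a.degree = b.degree) : a = b := by
  obtain ⟨c, rfl⟩ := exists_add_of_le h
  rw [map_add] at hd
  have hc : c = 0 := (Finsupp.degree_eq_zero_iff c).1 (by omega)
  rw [hc, add_zero]

theorem degree_of_mem_sumsOfCard {σ : Type*} {A : Set (σ →₀ ℕ)} {k s : ℕ}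
    (hA : ∀ a ∈ A, a.degree = k) {m : σ →₀ ℕ} (hm : m ∈ sumsOfCard A s) :
    m.degree = s * k := by
  obtain ⟨T, rfl, hT, rfl⟩ := hm
  rw [map_multiset_sum, Multiset.map_congr rfl fun a ha => hA a (hT a ha)]
  simp

theorem Multiset.exists_sum_eq_of_mem_triple {M : Type*} [AddCommMonoid M] {a b c : M}
    (T : Multiset M) (hT : ∀ x ∈ T, x = a ∨ x = b ∨ x = c) :
    ∃ p q r : ℕ, p + q + r = T.card ∧ T.sum = p • a + q • b + r • c := by
  induction T using Multiset.induction_on with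
  | empty => exact ⟨0, 0, 0, by simp⟩
  | cons x T ih =>
    obtain ⟨p, q, r, hc, hs⟩ := ih fun y hy => hT y (Multiset.mem_cons_of_mem hy)
    rw [Multiset.card_cons, Multiset.sum_cons, hs, ← hc]
    rcases hT x (Multiset.mem_cons_self _ _) with rfl | rfl | rfl
    · exact ⟨p + 1, q, r, by omega, by rw [succ_nsmul]; abel⟩
    · exact ⟨p, q + 1, r, by omega, by rw [succ_nsmul]; abel⟩
    · exact ⟨p, q, r + 1, by omega, by rw [succ_nsmul]; abel⟩

theorem nsmul_add_nsmul_add_nsmul_mem_sumsOfCard {M : Type*} [AddCommMonoid M] {A : Set M}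
    {a b c : M} (ha : a ∈ A) (hb : b ∈ A) (hc : c ∈ A) (p q r : ℕ) :
    p • a + q • b + r • c ∈ sumsOfCard A (p + q + r) := by
  refine ⟨Multiset.replicate p a + Multiset.replicate q b + Multiset.replicate r c,
    by simp, fun x hx => ?_, by simp⟩
  simp only [Multiset.mem_add] at hx
  rcases hx with (hx | hx) | hx <;> rw [Multiset.eq_of_mem_replicate hx] <;> assumption

/-- Let `I` be a square-free monomial ideal generated in degree `k ≥ 1`, with minimal
monomial generators `G`, and let `u_1,…,u_t ∈ G(I)` (`t ≥ 3`) form an induced matching.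
Then for every `s ≥ 2` and all pairwise distinct `i, j, l`: the elements of `G(I^s)`
dividing `u_i^s u_j u_l` are exactly the four pairwise distinct monomials `u_i^s`,
`u_i^{s-1} u_j`, `u_i^{s-1} u_l` and `u_i^{s-2} u_j u_l`.  (On exponent vectors, powers
are scalar multiples, products are sums and divisibility is `≤`.) -/
theorem induced_matching_generators_of_power_divisors_three
    {K : Type} [Field K] {n : ℕ}
    (I : Ideal (MvPolynomial (Fin n) K)) (G : Finset (Fin n →₀ ℕ)) (hG : IsMinGen K G I)
    (k : ℕ) (hk : 1 ≤ k)
    (hsf : ∀ a ∈ G, ∀ i, a i ≤ 1)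
    (hdeg : ∀ a ∈ G, (a.sum fun _ e => e) = k)
    (t : ℕ) (ht : 3 ≤ t) (u : Fin t → (Fin n →₀ ℕ)) (humem : ∀ i, u i ∈ G)
    (hmatch₁ : ∀ i j, i ≠ j → u i ⊓ u j = 0)
    (hmatch₂ : ∀ w ∈ G, w ≤ ∑ i, u i → ∃ i, w = u i)
    (s : ℕ) (hs : 2 ≤ s)
    (Gs : Finset (Fin n →₀ ℕ)) (hGs : IsMinGen K Gs (I ^ s))
    (i j l : Fin t) (hij : i ≠ j) (hil : i ≠ l) (hjl : j ≠ l) :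
    s • u i ∈ Gs ∧
    (s - 1) • u i + u j ∈ Gs ∧
    (s - 1) • u i + u l ∈ Gs ∧
    (s - 2) • u i + u j + u l ∈ Gs ∧
    List.Pairwise (· ≠ ·)
      [s • u i, (s - 1) • u i + u j, (s - 1) • u i + u l, (s - 2) • u i + u j + u l] ∧
    (∀ m ∈ [s • u i, (s - 1) • u i + u j, (s - 1) • u i + u l, (s - 2) • u i + u j + u l],
      m ≤ s • u i + u j + u l) ∧
    ∀ w ∈ Gs, w ≤ s • u i + u j + u l →
      w = s • u i ∨ w = (s - 1) • u i + u j ∨ w = (s - 1) • u i + u l ∨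
        w = (s - 2) • u i + u j + u l := by
  have hdeg' : ∀ a ∈ (G : Set (Fin n →₀ ℕ)), a.degree = k := fun a ha => hdeg a ha
  have hmem : ∀ w, w ∈ Gs ↔ w ∈ sumsOfCard (G : Set (Fin n →₀ ℕ)) s := by
    rw [hG.1, mIdeal_pow] at hGs
    exact hGs.mem_iff_of_antichain fun a ha b hb hab => Finsupp.eq_of_le_of_degree_eq hab
      ((degree_of_mem_sumsOfCard hdeg' ha).trans (degree_of_mem_sumsOfCard hdeg' hb).symm)
  have hmem' : ∀ p q r, p + q + r = s → p • u i + q • u j + r • u l ∈ Gs := by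
    rintro p q r rfl
    exact (hmem _).2
      (nsmul_add_nsmul_add_nsmul_mem_sumsOfCard (humem i) (humem j) (humem l) p q r)
  have hpoint : ∀ p, ∃ x, u p x = 1 ∧ ∀ q, p ≠ q → u q x = 0 := by
    intro p
    have hne : u p ≠ 0 := fun h => by
      have := hdeg' _ (humem p)
      rw [h, map_zero] at this
      omega
    obtain ⟨x, hx⟩ := Finsupp.ne_iff.1 hne
    have h1 := hsf _ (humem p) x
    simp only [Finsupp.coe_zero, Pi.zero_apply] at hx
    refine ⟨x, by omega, fun q hpq => ?_⟩
    have := DFunLike.congr_fun (hmatch₁ p q hpq) x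
    simp only [Finsupp.inf_apply, Finsupp.coe_zero, Pi.zero_apply] at this
    omega
  obtain ⟨y, hyj, hy⟩ := hpoint j
  obtain ⟨z, hzl, hz⟩ := hpoint l
  have hyi := hy i hij.symm
  have hyl := hy l hjl
  have hzi := hz i hil.symm
  have hzj := hz j hjl.symm
  have hne : ∀ a b : Fin n →₀ ℕ, (a y ≠ b y ∨ a z ≠ b z) → a ≠ b := by
    rintro a _ h rfl
    simp at h
  refine ⟨by simpa using hmem' s 0 0 rfl, by simpa using hmem' (s - 1) 1 0 (by omega),
    by simpa using hmem' (s - 1) 0 1 (by omega), by simpa using hmem' (s - 2) 1 1 (by omega),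
    ?_, ?_, ?_⟩
  · simp only [List.pairwise_cons, List.mem_cons, List.not_mem_nil, or_false, forall_eq_or_imp,
      forall_eq, List.Pairwise.nil, and_true, IsEmpty.forall_iff, implies_true]
    refine ⟨⟨?_, ?_, ?_⟩, ⟨?_, ?_⟩, ?_⟩ <;> apply hne <;> simp [*]
  · have hle : ∀ p q r, p ≤ s → q ≤ 1 → r ≤ 1 →
        p • u i + q • u j + r • u l ≤ s • u i + u j + u l := by
      intro p q r hp hq hr
      calc p • u i + q • u j + r • u l ≤ s • u i + 1 • u j + 1 • u l := by gcongr
        _ = _ := by simp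
    simp only [List.mem_cons, List.not_mem_nil, or_false, forall_eq_or_imp, forall_eq]
    refine ⟨?_, ?_, ?_, ?_⟩
    · simpa using hle s 0 0 le_rfl (by simp) (by simp)
    · simpa using hle (s - 1) 1 0 (by omega) (by simp) (by simp)
    · simpa using hle (s - 1) 0 1 (by omega) (by simp) (by simp)
    · simpa using hle (s - 2) 1 1 (by omega) (by simp) (by simp)
  · intro w hw hle
    obtain ⟨T, hc, hT, rfl⟩ := (hmem w).1 hw
    have hthree : u i + u j + u l ≤ ∑ p, u p := by
      calc u i + u j + u l = ∑ p ∈ {i, j, l}, u p := by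
            rw [Finset.sum_insert (by simp [hij, hil]), Finset.sum_insert (by simp [hjl]),
              Finset.sum_singleton, add_assoc]
        _ ≤ _ := Finset.sum_le_sum_of_subset (Finset.subset_univ _)
    have hfactor : ∀ a ∈ T, a = u i ∨ a = u j ∨ a = u l := by
      intro a ha
      have haT : a ≤ s • u i + u j + u l := (Multiset.le_sum_of_mem ha).trans hle
      have ha3 : a ≤ u i + u j + u l := fun x => by
        have h1 := hsf a (hT a ha) x
        have h2 := haT x
        simp only [Finsupp.add_apply, Finsupp.smul_apply, smul_eq_mul] at h2 ⊢
        rcases Nat.eq_zero_or_pos (u i x) with h | h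
        · simpa [h] using h2
        · omega
      obtain ⟨p, rfl⟩ := hmatch₂ a (hT a ha) (ha3.trans hthree)
      by_contra! hcon
      obtain ⟨x, hx1, hx⟩ := hpoint p
      have h := ha3 x
      rw [Finsupp.add_apply, Finsupp.add_apply, hx i fun e => hcon.1 (e ▸ rfl),
        hx j fun e => hcon.2.1 (e ▸ rfl), hx l fun e => hcon.2.2 (e ▸ rfl)] at h
      omega
    obtain ⟨p, q, r, hpqr, hsum⟩ := T.exists_sum_eq_of_mem_triple hfactor
    rw [hsum] at hle ⊢
    have hq : q ≤ 1 := by simpa [hyi, hyj, hyl] using hle y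
    have hr : r ≤ 1 := by simpa [hzi, hzj, hzl] using hle z
    obtain rfl : p = s - q - r := by omega
    interval_cases q <;> interval_cases r <;> simp [Nat.sub_sub]
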